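/- Let S = ⟨a,b⟩ with a < b coprime positive integers and F = ab - a - b. For every integer x with 0 ≤ x ≤ F, exactly one of x and F - x belongs to S. -/

import Mathlib

theorem frobenius_symmetry (a b : ℤ) (ha : 0 < a) (hab : a < b) (hco : IsCoprime a b)
    (x : ℤ) (hx0 : 0 ≤ x) (hxF : x ≤ a * b - a - b) :
    Xor' (∃ u v : ℕ, x = u * a + v * b)
         (∃ u v : ℕ, a * b - a - b - x = u * a + v * b) := by
  have hb : 0 < b := ha.trans hab
  have hnot : ¬ ((∃ u v : ℕ, x = u * a + v * b) ∧
      (∃ u v : ℕ, a * b - a - b - x = u * a + v * b)) := by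
    rintro ⟨⟨u, v, h1⟩, ⟨u', v', h2⟩⟩
    have hd : b ∣ ((u : ℤ) + u' + 1) * a := ⟨a - (v + v' + 1), by linear_combination -h1 - h2⟩
    have hd2 : b ∣ ((u : ℤ) + u' + 1) := hco.symm.dvd_of_dvd_mul_right hd
    have hle : b ≤ (u : ℤ) + u' + 1 := Int.le_of_dvd (by positivity) hd2
    have h3 : b * a ≤ ((u : ℤ) + u' + 1) * a := mul_le_mul_of_nonneg_right hle ha.le
    have h4 : 0 < ((v : ℤ) + v' + 1) * b := by positivity
    nlinarith
  have hor : (∃ u v : ℕ, x = u * a + v * b) ∨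
      (∃ u v : ℕ, a * b - a - b - x = u * a + v * b) := by
    obtain ⟨s, t, hst⟩ := hco
    have hu0 := Int.emod_nonneg (x * s) hb.ne'
    have hu1 := Int.emod_lt_of_pos (x * s) hb
    have hdiv := Int.emod_add_mul_ediv (x * s) b
    obtain ⟨u, hu⟩ : ∃ u, u = (x * s) % b := ⟨_, rfl⟩
    obtain ⟨q, hq⟩ : ∃ q, q = (x * s) / b := ⟨_, rfl⟩
    rw [← hu] at hu0 hu1 hdiv
    rw [← hq] at hdiv
    obtain ⟨v, hv⟩ : ∃ v, v = x * t + q * a := ⟨_, rfl⟩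
    have hx : x = u * a + v * b := by
      rw [hv]; linear_combination (-x) * hst - a * hdiv
    rcases le_or_gt 0 v with h | h
    · left
      refine ⟨u.toNat, v.toNat, ?_⟩
      rw [Int.toNat_of_nonneg hu0, Int.toNat_of_nonneg h]; exact hx
    · right
      refine ⟨(b - 1 - u).toNat, (-1 - v).toNat, ?_⟩
      rw [Int.toNat_of_nonneg (by omega), Int.toNat_of_nonneg (by omega)]
      linear_combination -hx
  rcases hor with h | h
  · exact Or.inl ⟨h, fun k => hnot ⟨h, k⟩⟩
  · exact Or.inr ⟨h, fun k => hnot ⟨k, h⟩⟩
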